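/- arXiv:2009.13710 — 5 statements merged into one kernel-verified Lean document; each statement's English description precedes it below -/
import Mathlib

section
/- Let ℓ ≥ 2 and m ≥ 0 be integers. The ℓ vectors η_0^m, η_1^m, …, η_{ℓ-2}^m, θ_0 form a basis of the S-module D(B_ℓ, 2m+1); that is, they are S-linearly independent and every element of D(B_ℓ, 2m+1) is an S-linear combination of them. -/
open MvPolynomial Polynomial

noncomputable section

abbrev S (ℓ : ℕ) := MvPolynomial (Fin ℓ) ℂ

def defInt {A : Type*} [CommRing A] [Algebra ℚ A] (a b : A) (h : Polynomial A) : A :=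
  h.sum fun n c => (((n : ℚ) + 1)⁻¹ • c) * (b ^ (n + 1) - a ^ (n + 1))

def gpoly (ℓ : ℕ) : Polynomial (S ℓ) :=
  ∏ p : Fin ℓ, (Polynomial.X - Polynomial.C (MvPolynomial.X p))

def eta (ℓ k m : ℕ) : Fin ℓ → S ℓ := fun i =>
  ∑ j : Fin ℓ, defInt (MvPolynomial.X i) (MvPolynomial.X j)
    (Polynomial.X ^ k * gpoly ℓ ^ m)

def DB (ℓ m : ℕ) : Submodule (S ℓ) (Fin ℓ → S ℓ) where
  carrier := {f | ∀ i j : Fin ℓ, i < j →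
    (MvPolynomial.X i - MvPolynomial.X j) ^ m ∣ f i - f j}
  zero_mem' := by intro i j _; simp
  add_mem' := by
    intro f g hf hg i j hij
    have h := (hf i j hij).add (hg i j hij)
    have : f i - f j + (g i - g j) = (f + g) i - (f + g) j := by
      simp [Pi.add_apply]; ring
    rwa [this] at h
  smul_mem' := by
    intro c f hf i j hij
    have h := (hf i j hij).mul_left c
    have : c * (f i - f j) = (c • f) i - (c • f) j := by
      simp [Pi.smul_apply, smul_eq_mul]; ring
    rwa [this] at h

def theta0 (ℓ : ℕ) : Fin ℓ → S ℓ := fun _ => 1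

/-- The family η_0^m, …, η_{ℓ-2}^m, θ_0 (θ_0 at the last index). -/
def etaBasis (ℓ m : ℕ) : Fin ℓ → (Fin ℓ → S ℓ) := fun a =>
  if (a : ℕ) < ℓ - 1 then eta ℓ (a : ℕ) m else theta0 ℓ

theorem eq_of_derivative_eq {A : Type*} [CommRing A] [IsDomain A] [CharZero A]
    {P R : Polynomial A} (h : derivative P = derivative R) (a b : A) :
    P.eval b - P.eval a = R.eval b - R.eval a := by
  have h0 : derivative (P - R) = 0 := by rw [derivative_sub, h, sub_self]
  have h1 := Polynomial.eq_C_of_derivative_eq_zero h0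
  have h2 : P = R + Polynomial.C ((P - R).coeff 0) := by rw [← h1]; ring
  rw [h2]
  simp

/-- The formal antiderivative with zero constant term. -/
def antiderivative {A : Type*} [CommRing A] [Algebra ℚ A] (h : Polynomial A) : Polynomial A :=
  h.sum fun n c => Polynomial.monomial (n + 1) (((n : ℚ) + 1)⁻¹ • c)

theorem derivative_antiderivative {A : Type*} [CommRing A] [Algebra ℚ A] (h : Polynomial A) :
    derivative (antiderivative h) = h := by
  conv_rhs => rw [← Polynomial.sum_monomial_eq h]
  rw [antiderivative, Polynomial.sum, Polynomial.sum, map_sum]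
  refine Finset.sum_congr rfl fun n _ => ?_
  rw [derivative_monomial, Nat.add_sub_cancel]
  congr 1
  have hn : ((n : ℚ) + 1) ≠ 0 := by positivity
  have hc : ((n + 1 : ℕ) : A) = algebraMap ℚ A ((n : ℚ) + 1) := by simp
  rw [hc, mul_comm, ← Algebra.smul_def, smul_smul, mul_inv_cancel₀ hn, one_smul]

theorem defInt_eq_eval_antiderivative {A : Type*} [CommRing A] [Algebra ℚ A] (a b : A)
    (h : Polynomial A) :
    defInt a b h = (antiderivative h).eval b - (antiderivative h).eval a := by
  simp only [defInt, antiderivative, Polynomial.sum, eval_finsetSum, Polynomial.eval_monomial,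
    mul_sub, Finset.sum_sub_distrib]

theorem pow_dvd_eval_sub_eval {A : Type*} [CommRing A] [IsDomain A] [CharZero A] [Algebra ℚ A]
    {P q : Polynomial A} {a b : A} {m n : ℕ}
    (h : derivative P = (Polynomial.X - Polynomial.C a) ^ m *
      (Polynomial.X - Polynomial.C b) ^ n * q) :
    (b - a) ^ (m + n + 1) ∣ P.eval b - P.eval a := by
  set L : Polynomial A := Polynomial.C a + Polynomial.C (b - a) * Polynomial.X with hL
  set w : Polynomial A := Polynomial.X ^ m * (Polynomial.X - 1) ^ n * q.comp L with hw
  have key : derivative (P.comp L) =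
      derivative (Polynomial.C ((b - a) ^ (m + n + 1)) * antiderivative w) := by
    rw [derivative_C_mul, derivative_antiderivative, derivative_comp, h]
    simp only [mul_comp, pow_comp, sub_comp, X_comp, C_comp]
    have h1 : L - Polynomial.C a = Polynomial.C (b - a) * Polynomial.X := by rw [hL]; ring
    have h2 : L - Polynomial.C b = Polynomial.C (b - a) * (Polynomial.X - 1) := by
      rw [hL, Polynomial.C_sub]; ring
    have h3 : derivative L = Polynomial.C (b - a) := by simp [hL]
    rw [h1, h2, h3, hw, Polynomial.C_pow, mul_pow, mul_pow]
    ring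
  have := eq_of_derivative_eq key 0 1
  simp only [eval_comp, Polynomial.eval_mul, Polynomial.eval_C, ← mul_sub] at this
  have e1 : L.eval 1 = b := by simp [hL]
  have e0 : L.eval 0 = a := by simp [hL]
  rw [e1, e0] at this
  exact ⟨_, this⟩

theorem natDegree_gpoly (ℓ : ℕ) : (gpoly ℓ).natDegree = ℓ := by
  simp [gpoly]

theorem gpoly_monic (ℓ : ℕ) : (gpoly ℓ).Monic :=
  monic_prod_of_monic _ _ fun _ _ => monic_X_sub_C _

theorem eta_apply (ℓ k m : ℕ) (i : Fin ℓ) :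
    eta ℓ k m i =
      ∑ j, (antiderivative (Polynomial.X ^ k * gpoly ℓ ^ m)).eval (MvPolynomial.X j) -
      (ℓ : S ℓ) *
        (antiderivative (Polynomial.X ^ k * gpoly ℓ ^ m)).eval (MvPolynomial.X i) := by
  simp [_root_.eta, defInt_eq_eval_antiderivative, Finset.sum_sub_distrib]

theorem eta_mem_DB (ℓ k m : ℕ) : eta ℓ k m ∈ DB ℓ (2 * m + 1) := by
  intro i j hij
  have hg : (Polynomial.X - Polynomial.C (MvPolynomial.X i : S ℓ)) *
      (Polynomial.X - Polynomial.C (MvPolynomial.X j : S ℓ)) ∣ gpoly ℓ := by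
    rw [gpoly, ← Finset.prod_pair (f := fun p : Fin ℓ =>
      Polynomial.X - Polynomial.C (MvPolynomial.X p : S ℓ)) hij.ne]
    exact Finset.prod_dvd_prod_of_subset _ _ _ (Finset.subset_univ _)
  obtain ⟨q, hq⟩ := hg
  have hd := pow_dvd_eval_sub_eval (a := (MvPolynomial.X j : S ℓ)) (b := MvPolynomial.X i)
    (P := antiderivative (Polynomial.X ^ k * gpoly ℓ ^ m)) (m := m) (n := m)
    (q := Polynomial.X ^ k * q ^ m) (by rw [derivative_antiderivative, hq, mul_pow, mul_pow]; ring)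
  rw [eta_apply, eta_apply, two_mul]
  obtain ⟨c, hc⟩ := hd
  refine ⟨-(ℓ : S ℓ) * c, ?_⟩
  linear_combination (-(ℓ : S ℓ)) * hc

theorem etaBasis_mem_DB (ℓ m : ℕ) (a : Fin ℓ) : etaBasis ℓ m a ∈ DB ℓ (2 * m + 1) := by
  unfold etaBasis
  split_ifs
  · exact eta_mem_DB ℓ a m
  · intro i j _
    simp [theta0]

theorem X_sub_C_pow_succ_dvd_of_derivative {A : Type*} [CommRing A] [IsDomain A] [CharZero A]
    {P : Polynomial A} {a : A} {m : ℕ} (hP : P.derivative ≠ 0) (ha : P.IsRoot a)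
    (h : (Polynomial.X - Polynomial.C a) ^ m ∣ derivative P) :
    (Polynomial.X - Polynomial.C a) ^ (m + 1) ∣ P := by
  have hP0 : P ≠ 0 := fun h0 => hP (by simp [h0])
  have h1 := (le_rootMultiplicity_iff hP).2 h
  rw [derivative_rootMultiplicity_of_root ha] at h1
  have h2 := (rootMultiplicity_pos hP0).2 ha
  exact (le_rootMultiplicity_iff hP0).1 (by omega)

theorem prod_X_sub_C_pow_succ_dvd_of_derivative {A ι : Type*} [CommRing A] [IsDomain A]
    [UniqueFactorizationMonoid A] [CharZero A] [Fintype ι] {a : ι → A}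
    (hinj : Function.Injective a) {m : ℕ} {P : Polynomial A} (hP : P.derivative ≠ 0)
    (ha : ∀ i, P.IsRoot (a i))
    (h : (∏ i, (Polynomial.X - Polynomial.C (a i))) ^ m ∣ derivative P) :
    (∏ i, (Polynomial.X - Polynomial.C (a i))) ^ (m + 1) ∣ P := by
  rw [← Finset.prod_pow]
  refine Finset.prod_dvd_of_isRelPrime ?_ fun i _ => ?_
  · intro i _ j _ hij
    refine IsRelPrime.pow ?_
    have hirr : Irreducible (Polynomial.X - Polynomial.C (a i)) := Polynomial.irreducible_X_sub_C _
    refine hirr.isRelPrime_iff_not_dvd.2 fun hdvd => hij (hinj ?_)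
    simpa [sub_eq_zero] using dvd_iff_isRoot.1 hdvd
  · have hdvd : Polynomial.X - Polynomial.C (a i) ∣ ∏ j, (Polynomial.X - Polynomial.C (a j)) :=
      Finset.dvd_prod_of_mem (fun j => Polynomial.X - Polynomial.C (a j)) (Finset.mem_univ i)
    exact X_sub_C_pow_succ_dvd_of_derivative hP (ha i) ((pow_dvd_pow_of_dvd hdvd m).trans h)

theorem eq_zero_of_derivative_eq_mul_gpoly_pow {ℓ m : ℕ} {P p : Polynomial (S ℓ)}
    (hP : derivative P = p * gpoly ℓ ^ m) (hp : p.natDegree + 1 < ℓ)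
    (hc : ∀ i j : Fin ℓ, P.eval (MvPolynomial.X i) = P.eval (MvPolynomial.X j)) : p = 0 := by
  by_contra hp0
  have hg := gpoly_monic ℓ
  have hd0 : derivative P ≠ 0 := by
    rw [hP]
    exact mul_ne_zero hp0 (pow_ne_zero _ hg.ne_zero)
  let i₀ : Fin ℓ := ⟨0, by omega⟩
  set R := P - Polynomial.C (P.eval (MvPolynomial.X i₀)) with hR
  have hRd : derivative R = derivative P := by simp [hR]
  have hdvd : gpoly ℓ ^ (m + 1) ∣ R := by
    refine prod_X_sub_C_pow_succ_dvd_of_derivative MvPolynomial.X_injective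
      (by rwa [hRd]) (fun i => ?_) ?_
    · simp [hR, Polynomial.IsRoot, hc i i₀]
    · rw [hRd, hP]
      exact Dvd.intro_left _ rfl
  have hR0 : R ≠ 0 := fun h0 => hd0 (by rw [← hRd, h0, derivative_zero])
  have h1 := natDegree_le_of_dvd hdvd hR0
  rw [natDegree_pow, natDegree_gpoly] at h1
  have h2 : (derivative R).natDegree = R.natDegree - 1 := natDegree_derivative R
  rw [hRd, hP, natDegree_mul hp0 (pow_ne_zero _ hg.ne_zero), natDegree_pow,
    natDegree_gpoly] at h2
  rw [add_mul] at h1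
  omega

theorem linearIndependent_etaBasis (ℓ : ℕ) (hℓ : 2 ≤ ℓ) (m : ℕ) :
    LinearIndependent (S ℓ) (etaBasis ℓ m) := by
  rw [Fintype.linearIndependent_iff]
  intro c hc
  obtain ⟨n, rfl⟩ : ∃ n, ℓ = n + 1 := ⟨ℓ - 1, by omega⟩
  set F : Fin n → Polynomial (S (n + 1)) := fun a =>
    antiderivative (Polynomial.X ^ (a : ℕ) * gpoly (n + 1) ^ m) with hF
  set p : Polynomial (S (n + 1)) :=
    ∑ a : Fin n, Polynomial.C (c a.castSucc) * Polynomial.X ^ (a : ℕ) with hp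
  set P : Polynomial (S (n + 1)) := ∑ a : Fin n, Polynomial.C (c a.castSucc) * F a with hPdef
  have hP : derivative P = p * gpoly (n + 1) ^ m := by
    simp only [hPdef, hp, hF, derivative_sum, derivative_C_mul, derivative_antiderivative,
      Finset.sum_mul, mul_assoc]
  have hcoord (i : Fin (n + 1)) :
      ∑ a : Fin n, c a.castSucc * eta (n + 1) a m i + c (Fin.last n) = 0 := by
    have := congrFun hc i
    simpa [Fin.sum_univ_castSucc, etaBasis, theta0] using this
  have heval (i : Fin (n + 1)) : ∑ a : Fin n, c a.castSucc * eta (n + 1) a m i =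
      ∑ j, P.eval (MvPolynomial.X j) - ((n + 1 : ℕ) : S (n + 1)) * P.eval (MvPolynomial.X i) := by
    simp only [eta_apply, mul_sub, Finset.sum_sub_distrib, hPdef, hF, eval_finsetSum,
      Polynomial.eval_mul, Polynomial.eval_C, Finset.mul_sum]
    rw [Finset.sum_comm]
    congr 1
    exact Finset.sum_congr rfl fun a _ => by ring
  have hp0 : p = 0 := by
    refine eq_zero_of_derivative_eq_mul_gpoly_pow hP ?_ fun i j => ?_
    · have : p.natDegree ≤ n - 1 := by
        refine natDegree_sum_le_of_forall_le _ _ fun a _ => ?_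
        exact (natDegree_C_mul_X_pow_le _ _).trans (by omega)
      omega
    · have hn : ((n + 1 : ℕ) : S (n + 1)) ≠ 0 := Nat.cast_ne_zero.2 n.succ_ne_zero
      apply mul_left_cancel₀ hn
      linear_combination hcoord j - hcoord i + heval i - heval j
  have hcs (a : Fin n) : c a.castSucc = 0 := by
    have := congrArg (fun q : Polynomial (S (n + 1)) => q.coeff a) hp0
    simpa [hp, finsetSum_coeff, Polynomial.coeff_X_pow, Fin.val_inj] using this
  intro a
  refine Fin.lastCases ?_ hcs a
  simpa [hcs] using hcoord (Fin.last n)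

/-- `h` has degree at most `d` jointly in `t` and in the variables of the coefficients. -/
def JointDegreeLE {ℓ : ℕ} (d : ℕ) (h : Polynomial (S ℓ)) : Prop :=
  ∀ n, h.coeff n ≠ 0 → (h.coeff n).totalDegree + n ≤ d

theorem JointDegreeLE.mul {ℓ d e : ℕ} {h k : Polynomial (S ℓ)} (hh : JointDegreeLE d h)
    (hk : JointDegreeLE e k) : JointDegreeLE (d + e) (h * k) := by
  intro n hn
  rw [Polynomial.coeff_mul] at hn ⊢
  have key : ∀ x ∈ Finset.HasAntidiagonal.antidiagonal n, h.coeff x.1 * k.coeff x.2 ≠ 0 →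
      (h.coeff x.1 * k.coeff x.2).totalDegree + n ≤ d + e := by
    intro x hx hne
    have h1 := hh x.1 (left_ne_zero_of_mul hne)
    have h2 := hk x.2 (right_ne_zero_of_mul hne)
    have h3 := totalDegree_mul (h.coeff x.1) (k.coeff x.2)
    rw [Finset.HasAntidiagonal.mem_antidiagonal] at hx
    omega
  obtain ⟨y, hy, hy0⟩ := Finset.exists_ne_zero_of_sum_ne_zero hn
  have hle := key y hy hy0
  suffices (∑ x ∈ Finset.HasAntidiagonal.antidiagonal n,
      h.coeff x.1 * k.coeff x.2).totalDegree ≤ d + e - n by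
    omega
  refine totalDegree_finsetSum_le fun x hx => ?_
  by_cases h0 : h.coeff x.1 * k.coeff x.2 = 0
  · simp [h0]
  · have := key x hx h0
    omega

theorem JointDegreeLE.one {ℓ : ℕ} : JointDegreeLE 0 (1 : Polynomial (S ℓ)) := by
  intro n hn
  rw [Polynomial.coeff_one] at hn ⊢
  split_ifs at hn ⊢ with h
  · simp [h]
  · exact absurd rfl hn

theorem JointDegreeLE.pow {ℓ d : ℕ} {h : Polynomial (S ℓ)} (hh : JointDegreeLE d h) (m : ℕ) :
    JointDegreeLE (m * d) (h ^ m) := by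
  induction m with
  | zero => simpa using JointDegreeLE.one
  | succ m ih => rw [pow_succ, add_mul, one_mul]; exact ih.mul hh

theorem JointDegreeLE.prod {ℓ : ℕ} {ι : Type*} (s : Finset ι) (f : ι → Polynomial (S ℓ))
    (d : ι → ℕ) (hf : ∀ i ∈ s, JointDegreeLE (d i) (f i)) :
    JointDegreeLE (∑ i ∈ s, d i) (∏ i ∈ s, f i) := by
  classical
  induction s using Finset.induction_on with
  | empty => simpa using JointDegreeLE.one
  | insert a s ha ih =>
    rw [Finset.sum_insert ha, Finset.prod_insert ha]
    exact (hf a (Finset.mem_insert_self a s)).mul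
      (ih fun i hi => hf i (Finset.mem_insert_of_mem hi))

theorem jointDegreeLE_X (ℓ : ℕ) : JointDegreeLE 1 (Polynomial.X : Polynomial (S ℓ)) := by
  intro n hn
  rw [Polynomial.coeff_X] at hn ⊢
  split_ifs at hn ⊢ with h
  · simp [← h]
  · exact absurd rfl hn

theorem jointDegreeLE_X_sub_C {ℓ : ℕ} (i : Fin ℓ) :
    JointDegreeLE 1 (Polynomial.X - Polynomial.C (MvPolynomial.X i : S ℓ)) := by
  intro n hn
  match n with
  | 0 => simp [totalDegree_neg]
  | 1 => simp
  | n + 2 => simp [Polynomial.coeff_X] at hn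

theorem jointDegreeLE_gpoly (ℓ : ℕ) : JointDegreeLE ℓ (gpoly ℓ) := by
  have := JointDegreeLE.prod Finset.univ _ (fun _ => 1)
    fun (i : Fin ℓ) _ => jointDegreeLE_X_sub_C i
  simpa [gpoly] using this

theorem JointDegreeLE.totalDegree_defInt_le {ℓ d : ℕ} {h : Polynomial (S ℓ)}
    (hh : JointDegreeLE d h) (i j : Fin ℓ) :
    (defInt (MvPolynomial.X i) (MvPolynomial.X j) h).totalDegree ≤ d + 1 := by
  rw [defInt, Polynomial.sum]
  refine totalDegree_finsetSum_le fun n hn => ?_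
  have h1 := hh n (mem_support_iff.1 hn)
  have h2 := totalDegree_smul_le (((n : ℚ) + 1)⁻¹) (h.coeff n)
  have h3 : ((MvPolynomial.X j : S ℓ) ^ (n + 1) - MvPolynomial.X i ^ (n + 1)).totalDegree
      ≤ n + 1 :=
    (totalDegree_sub _ _).trans (by simp)
  refine (totalDegree_mul _ _).trans ?_
  omega

theorem totalDegree_eta_le (ℓ k m : ℕ) (i : Fin ℓ) :
    (eta ℓ k m i).totalDegree ≤ k + m * ℓ + 1 := by
  refine totalDegree_finsetSum_le fun j _ => ?_
  have := ((jointDegreeLE_X ℓ).pow k).mul ((jointDegreeLE_gpoly ℓ).pow m)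
  rw [mul_one] at this
  exact this.totalDegree_defInt_le i j

theorem totalDegree_det_le {σ R n : Type*} [CommRing R] [Fintype n] [DecidableEq n]
    (M : Matrix n n (MvPolynomial σ R)) (d : n → ℕ) (hM : ∀ i a, (M i a).totalDegree ≤ d a) :
    M.det.totalDegree ≤ ∑ a, d a := by
  rw [Matrix.det_apply]
  refine totalDegree_finsetSum_le fun τ _ => ?_
  refine (totalDegree_smul_le _ _).trans ((totalDegree_finsetProd _ _).trans ?_)
  exact Finset.sum_le_sum fun a _ => hM _ a

/-- The product of `(x_i - x_j) ^ m` over all `i < j`. -/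
def multiDiscriminant (ℓ m : ℕ) : S ℓ :=
  ∏ i : Fin ℓ, ∏ j ∈ Finset.Ioi i, (MvPolynomial.X i - MvPolynomial.X j) ^ m

theorem X_sub_X_ne_zero {ℓ : ℕ} {i j : Fin ℓ} (hij : i ≠ j) :
    (MvPolynomial.X i - MvPolynomial.X j : S ℓ) ≠ 0 :=
  sub_ne_zero.2 (MvPolynomial.X_injective.ne hij)

theorem isHomogeneous_X_sub_X {ℓ : ℕ} (i j : Fin ℓ) :
    (MvPolynomial.X i - MvPolynomial.X j : S ℓ).IsHomogeneous 1 :=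
  (isHomogeneous_X ℂ i).sub (isHomogeneous_X ℂ j)

theorem multiDiscriminant_ne_zero (ℓ m : ℕ) : multiDiscriminant ℓ m ≠ 0 :=
  Finset.prod_ne_zero_iff.2 fun _ _ => Finset.prod_ne_zero_iff.2 fun _ hj =>
    pow_ne_zero _ (X_sub_X_ne_zero (Finset.mem_Ioi.1 hj).ne)

theorem totalDegree_multiDiscriminant (ℓ m : ℕ) :
    (multiDiscriminant ℓ m).totalDegree = ∑ i : Fin ℓ, (ℓ - 1 - (i : ℕ)) * m := by
  refine IsHomogeneous.totalDegree ?_ (multiDiscriminant_ne_zero ℓ m)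
  refine IsHomogeneous.prod _ _ _ fun i _ => ?_
  have := IsHomogeneous.prod (Finset.Ioi i)
    (fun j => (MvPolynomial.X i - MvPolynomial.X j : S ℓ) ^ m) (fun _ => 1 * m)
    fun j _ => (isHomogeneous_X_sub_X i j).pow m
  simpa [Fin.card_Ioi] using this

theorem irreducible_X_sub_X {ℓ : ℕ} {i j : Fin ℓ} (hij : i ≠ j) :
    Irreducible (MvPolynomial.X i - MvPolynomial.X j : S ℓ) := by
  refine irreducible_of_totalDegree_eq_one
    ((isHomogeneous_X_sub_X i j).totalDegree (X_sub_X_ne_zero hij)) fun x hx => ?_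
  have := hx (Finsupp.single i 1)
  rw [MvPolynomial.coeff_sub, MvPolynomial.coeff_X, MvPolynomial.coeff_single_X] at this
  simpa [hij.symm] using this

theorem isRelPrime_X_sub_X {ℓ : ℕ} {i j k l : Fin ℓ} (hij : i < j) (hkl : k < l)
    (hne : (i, j) ≠ (k, l)) :
    IsRelPrime (MvPolynomial.X i - MvPolynomial.X j : S ℓ)
      (MvPolynomial.X k - MvPolynomial.X l) := by
  rw [(irreducible_X_sub_X hij.ne).isRelPrime_iff_not_dvd]
  intro hdvd
  let x : Fin ℓ → ℂ := fun s => if s = j then ((i : ℕ) : ℂ) else ((s : ℕ) : ℂ)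
  have h1 := map_dvd (MvPolynomial.eval x) hdvd
  have h2 : x i - x j = 0 := by simp [x]
  rw [map_sub, map_sub, MvPolynomial.eval_X, MvPolynomial.eval_X, MvPolynomial.eval_X,
    MvPolynomial.eval_X, h2, zero_dvd_iff, sub_eq_zero] at h1
  simp only [ne_eq, Prod.mk.injEq] at hne
  simp only [x] at h1
  split_ifs at h1 <;> norm_cast at h1 <;> omega

theorem multiDiscriminant_dvd {ℓ m : ℕ} {f : S ℓ}
    (h : ∀ i j : Fin ℓ, i < j → (MvPolynomial.X i - MvPolynomial.X j) ^ m ∣ f) :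
    multiDiscriminant ℓ m ∣ f := by
  rw [multiDiscriminant, Finset.prod_sigma']
  refine Finset.prod_dvd_of_isRelPrime ?_ ?_
  · rintro ⟨i, j⟩ hij ⟨k, l⟩ hkl hne
    simp only [Finset.coe_sigma, Set.mem_sigma_iff, Finset.coe_Ioi, Set.mem_Ioi] at hij hkl
    refine IsRelPrime.pow (isRelPrime_X_sub_X hij.2 hkl.2 ?_)
    rintro ⟨⟩
    exact hne rfl
  · rintro ⟨i, j⟩ hij
    exact h i j (by simpa using hij)

theorem multiDiscriminant_dvd_det {ℓ m : ℕ} (M : Matrix (Fin ℓ) (Fin ℓ) (S ℓ))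
    (hM : ∀ a, M.col a ∈ DB ℓ m) : multiDiscriminant ℓ m ∣ M.det := by
  refine multiDiscriminant_dvd fun i j hij => ?_
  have hdvd (a : Fin ℓ) : (MvPolynomial.X i - MvPolynomial.X j : S ℓ) ^ m ∣ M i a - M j a :=
    hM a i j hij
  choose r hr using hdvd
  have : M i + (-1 : S ℓ) • M j = (MvPolynomial.X i - MvPolynomial.X j : S ℓ) ^ m • r := by
    ext1 a
    simpa [sub_eq_add_neg] using hr a
  rw [← Matrix.det_updateRow_add_smul_self M hij.ne (-1 : S ℓ), this, Matrix.det_updateRow_smul]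
  exact Dvd.intro _ rfl

theorem sum_degree_eq (n m : ℕ) :
    ∑ a : Fin (n + 1), (if (a : ℕ) < n then (a : ℕ) + m * (n + 1) + 1 else 0) =
      ∑ i : Fin (n + 1), (n - (i : ℕ)) * (2 * m + 1) := by
  rw [Fin.sum_univ_eq_sum_range (fun a => if a < n then a + m * (n + 1) + 1 else 0) (n + 1),
    Fin.sum_univ_eq_sum_range (fun a => (n - a) * (2 * m + 1)) (n + 1), ← Finset.sum_mul]
  have h1 : ∑ j ∈ Finset.range (n + 1), (n - j) = ∑ j ∈ Finset.range (n + 1), j := by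
    simpa using Finset.sum_range_reflect (fun j => j) (n + 1)
  have h2 : ∑ a ∈ Finset.range n, (if a < n then a + m * (n + 1) + 1 else 0) =
      ∑ a ∈ Finset.range n, (a + (m * (n + 1) + 1)) :=
    Finset.sum_congr rfl fun a ha => by rw [if_pos (Finset.mem_range.1 ha), add_assoc]
  have h3 := Finset.sum_range_id_mul_two (n + 1)
  rw [h1, Finset.sum_range_succ, h2, if_neg (lt_irrefl n), Finset.sum_add_distrib]
  rw [Finset.sum_range_succ, Nat.add_sub_cancel] at h3
  rw [Finset.sum_range_succ]
  simp only [Finset.sum_const, Finset.card_range, smul_eq_mul]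
  linear_combination m * h3.symm

/-- The matrix whose columns are the coefficient vectors of the family `etaBasis`. -/
def etaMatrix (ℓ m : ℕ) : Matrix (Fin ℓ) (Fin ℓ) (S ℓ) :=
  Matrix.of fun i a => etaBasis ℓ m a i

theorem etaMatrix_mulVec (ℓ m : ℕ) (c : Fin ℓ → S ℓ) :
    (etaMatrix ℓ m).mulVec c = ∑ a, c a • etaBasis ℓ m a := by
  ext1 i
  simp [etaMatrix, Matrix.mulVec, dotProduct, mul_comm]

theorem det_etaMatrix_ne_zero (ℓ : ℕ) (hℓ : 2 ≤ ℓ) (m : ℕ) : (etaMatrix ℓ m).det ≠ 0 := by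
  intro h0
  obtain ⟨c, hc0, hc⟩ := Matrix.exists_mulVec_eq_zero_iff.2 h0
  rw [etaMatrix_mulVec] at hc
  exact hc0 (funext (Fintype.linearIndependent_iff.1 (linearIndependent_etaBasis ℓ hℓ m) c hc))

theorem det_etaMatrix_dvd_multiDiscriminant (ℓ : ℕ) (hℓ : 2 ≤ ℓ) (m : ℕ) :
    (etaMatrix ℓ m).det ∣ multiDiscriminant ℓ (2 * m + 1) := by
  have hdet := det_etaMatrix_ne_zero ℓ hℓ m
  obtain ⟨u, hu⟩ := multiDiscriminant_dvd_det (etaMatrix ℓ m) (etaBasis_mem_DB ℓ m)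
  have hu0 : u ≠ 0 := by
    rintro rfl
    exact hdet (by rw [hu, mul_zero])
  have hle : (etaMatrix ℓ m).det.totalDegree ≤
      ∑ a : Fin ℓ, (if (a : ℕ) < ℓ - 1 then (a : ℕ) + m * ℓ + 1 else 0) := by
    refine totalDegree_det_le _ _ fun i a => ?_
    simp only [etaMatrix, Matrix.of_apply, etaBasis]
    split_ifs
    · exact totalDegree_eta_le ℓ a m i
    · simp [theta0]
  obtain ⟨n, rfl⟩ : ∃ n, ℓ = n + 1 := ⟨ℓ - 1, by omega⟩
  have hdeg := totalDegree_multiDiscriminant (n + 1) (2 * m + 1)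
  simp only [Nat.add_sub_cancel] at hle hdeg
  rw [sum_degree_eq, ← hdeg, hu,
    totalDegree_mul_of_isDomain (multiDiscriminant_ne_zero _ _) hu0] at hle
  have hu1 : u = MvPolynomial.C (MvPolynomial.coeff 0 u) :=
    totalDegree_eq_zero_iff_eq_C.1 (by omega)
  have hunit : IsUnit u := by
    rw [hu1] at hu0 ⊢
    exact (isUnit_iff_ne_zero.2 fun h => hu0 (by rw [h, map_zero])).map MvPolynomial.C
  rw [hu]
  exact hunit.mul_right_dvd.2 dvd_rfl

theorem mem_span_etaBasis (ℓ : ℕ) (hℓ : 2 ≤ ℓ) (m : ℕ) {v : Fin ℓ → S ℓ}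
    (hv : v ∈ DB ℓ (2 * m + 1)) :
    v ∈ Submodule.span (S ℓ) (Set.range (etaBasis ℓ m)) := by
  have hdvd (a : Fin ℓ) : (etaMatrix ℓ m).det ∣ (etaMatrix ℓ m).cramer v a := by
    refine (det_etaMatrix_dvd_multiDiscriminant ℓ hℓ m).trans ?_
    rw [Matrix.cramer_apply]
    refine multiDiscriminant_dvd_det _ fun b => ?_
    obtain rfl | hb := eq_or_ne b a
    · have : ((etaMatrix ℓ m).updateCol b v).col b = v := by
        ext1 i
        simp [Matrix.col]
      rwa [this]
    · have : ((etaMatrix ℓ m).updateCol a v).col b = etaBasis ℓ m b := by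
        ext1 i
        simp [Matrix.col, hb, etaMatrix]
      rw [this]
      exact etaBasis_mem_DB ℓ m b
  choose c hc using hdvd
  have hsum : (etaMatrix ℓ m).det • (∑ a, c a • etaBasis ℓ m a) = (etaMatrix ℓ m).det • v := by
    rw [← Matrix.mulVec_cramer (etaMatrix ℓ m) v, ← etaMatrix_mulVec, ← Matrix.mulVec_smul]
    congr 1
    ext1 a
    rw [hc, Pi.smul_apply, smul_eq_mul]
  rw [← smul_right_injective _ (det_etaMatrix_ne_zero ℓ hℓ m) hsum]
  exact Submodule.sum_mem _ fun a _ =>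
    Submodule.smul_mem _ _ (Submodule.subset_span (Set.mem_range_self a))

theorem stmt0 (ℓ : ℕ) (hℓ : 2 ≤ ℓ) (m : ℕ) :
    (∀ a : Fin ℓ, etaBasis ℓ m a ∈ DB ℓ (2 * m + 1)) ∧
    LinearIndependent (S ℓ) (etaBasis ℓ m) ∧
    (∀ v ∈ DB ℓ (2 * m + 1),
      v ∈ Submodule.span (S ℓ) (Set.range (etaBasis ℓ m))) := by
  refine ⟨etaBasis_mem_DB ℓ m, linearIndependent_etaBasis ℓ hℓ m, fun _ hv =>
    mem_span_etaBasis ℓ hℓ m hv⟩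

end
end

section
/- Let ℓ ≥ 2 and m, k ≥ 0 be integers. For all 1 ≤ i < j ≤ ℓ, the polynomial ∫_{x_i}^{x_j} t^k g(t)^m dt ∈ ℂ[x_1,…,x_ℓ] is divisible by (x_i − x_j)^{2m+1}. Consequently η_k^m ∈ D(B_ℓ, 2m+1). -/
open MvPolynomial Polynomial

noncomputable section

def DBset (ℓ m : ℕ) : Set (Fin ℓ → S ℓ) :=
  {f | ∀ i j : Fin ℓ, i < j →
    (MvPolynomial.X i - MvPolynomial.X j) ^ m ∣ f i - f j}

section DefInt

variable {A : Type*} [CommRing A] [Algebra ℚ A] (a b c : A)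

theorem defInt_add (h₁ h₂ : Polynomial A) :
    defInt a b (h₁ + h₂) = defInt a b h₁ + defInt a b h₂ := by
  unfold defInt
  apply Polynomial.sum_add_index
  · intro n
    simp
  · intro n c₁ c₂
    rw [smul_add, add_mul]

theorem defInt_monomial (n : ℕ) (r : A) :
    defInt a b (Polynomial.monomial n r) =
      (((n : ℚ) + 1)⁻¹ • r) * (b ^ (n + 1) - a ^ (n + 1)) := by
  unfold defInt
  apply Polynomial.sum_monomial_index
  simp

theorem defInt_C_mul (r : A) (h : Polynomial A) :
    defInt a b (Polynomial.C r * h) = r * defInt a b h := by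
  induction h using Polynomial.induction_on' with
  | add p q hp hq => rw [mul_add, defInt_add, defInt_add, hp, hq, mul_add]
  | monomial n s =>
    rw [Polynomial.C_mul_monomial, defInt_monomial, defInt_monomial, ← mul_smul_comm, mul_assoc]

/-- The fundamental theorem of calculus for `defInt`. -/
theorem defInt_derivative (F : Polynomial A) :
    defInt a b (Polynomial.derivative F) = F.eval b - F.eval a := by
  induction F using Polynomial.induction_on' with
  | add p q hp hq =>
    rw [Polynomial.derivative_add, defInt_add, hp, hq, Polynomial.eval_add, Polynomial.eval_add]
    ring
  | monomial n s =>
    rw [Polynomial.derivative_monomial, defInt_monomial]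
    cases n with
    | zero => simp
    | succ n =>
      have hn : ((n : ℚ) + 1) ≠ 0 := by positivity
      have hs : ((n : ℚ) + 1)⁻¹ • (s * ((n + 1 : ℕ) : A)) = s := by
        have hcast : s * ((n + 1 : ℕ) : A) = ((n : ℚ) + 1) • s := by
          rw [Algebra.smul_def, mul_comm]
          simp
        rw [hcast, smul_smul, inv_mul_cancel₀ hn, one_smul]
      rw [Nat.add_sub_cancel, hs, Polynomial.eval_monomial, Polynomial.eval_monomial, mul_sub]

theorem defInt_sub_defInt (h : Polynomial A) :
    defInt a c h - defInt b c h = defInt a b h := by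
  unfold defInt
  rw [Polynomial.sum_def, Polynomial.sum_def, Polynomial.sum_def, ← Finset.sum_sub_distrib]
  exact Finset.sum_congr rfl fun n _ => by ring

theorem defInt_X_sub_C_pow (n : ℕ) :
    defInt a b ((Polynomial.X - Polynomial.C a) ^ n) =
      algebraMap ℚ A ((n : ℚ) + 1)⁻¹ * (b - a) ^ (n + 1) := by
  have hn : ((n : ℚ) + 1) ≠ 0 := by positivity
  have hF : (Polynomial.X - Polynomial.C a) ^ n = Polynomial.derivative
      (Polynomial.C (algebraMap ℚ A ((n : ℚ) + 1)⁻¹) *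
        (Polynomial.X - Polynomial.C a) ^ (n + 1)) := by
    have hcast : ((n + 1 : ℕ) : A) = algebraMap ℚ A ((n : ℚ) + 1) := by simp
    rw [Polynomial.derivative_C_mul, Polynomial.derivative_X_sub_C_pow, Nat.add_sub_cancel,
      ← mul_assoc, ← Polynomial.C_mul, hcast, ← map_mul,
      inv_mul_cancel₀ hn, map_one, map_one, one_mul]
  rw [hF, defInt_derivative]
  simp only [Polynomial.eval_mul, Polynomial.eval_pow, Polynomial.eval_sub, Polynomial.eval_X,
    Polynomial.eval_C, sub_self, zero_pow n.succ_ne_zero, mul_zero, sub_zero]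

theorem sub_pow_dvd_defInt_X_sub_C_pow_mul (p : ℕ) (r : Polynomial A) :
    (b - a) ^ (p + 1) ∣ defInt a b ((Polynomial.X - Polynomial.C a) ^ p * r) := by
  obtain ⟨s, rfl⟩ : ∃ s : Polynomial A, r = s.comp (Polynomial.X - Polynomial.C a) :=
    ⟨r.comp (Polynomial.X + Polynomial.C a), by simp [Polynomial.comp_assoc]⟩
  induction s using Polynomial.induction_on' with
  | add s t hs ht =>
    rw [Polynomial.add_comp, mul_add, defInt_add]
    exact dvd_add hs ht
  | monomial n c =>
    rw [Polynomial.monomial_comp, mul_left_comm, ← pow_add, defInt_C_mul, defInt_X_sub_C_pow]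
    exact ((pow_dvd_pow _ (by omega)).mul_left _).mul_left _

theorem sub_pow_dvd_defInt (p q : ℕ) (r : Polynomial A) :
    (b - a) ^ (p + q + 1) ∣ defInt a b
      ((Polynomial.X - Polynomial.C a) ^ p * (Polynomial.X - Polynomial.C b) ^ q * r) := by
  induction q generalizing p with
  | zero => simpa using sub_pow_dvd_defInt_X_sub_C_pow_mul a b p r
  | succ q ih =>
    have hsplit : (Polynomial.X - Polynomial.C a) ^ p *
          (Polynomial.X - Polynomial.C b) ^ (q + 1) * r =
        (Polynomial.X - Polynomial.C a) ^ (p + 1) * (Polynomial.X - Polynomial.C b) ^ q * r +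
        Polynomial.C (a - b) *
          ((Polynomial.X - Polynomial.C a) ^ p * (Polynomial.X - Polynomial.C b) ^ q * r) := by
      rw [Polynomial.C_sub]
      ring
    rw [hsplit, defInt_add, defInt_C_mul]
    apply dvd_add
    · convert ih (p + 1) using 2
      ring
    · rw [← add_assoc, pow_succ']
      exact mul_dvd_mul (neg_sub b a ▸ (dvd_neg.mpr dvd_rfl)) (ih p)

end DefInt

theorem X_sub_C_mul_X_sub_C_dvd_gpoly {ℓ : ℕ} {i j : Fin ℓ} (hij : i ≠ j) :
    (Polynomial.X - Polynomial.C (MvPolynomial.X i)) *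
      (Polynomial.X - Polynomial.C (MvPolynomial.X j)) ∣ gpoly ℓ := by
  unfold gpoly
  rw [← Finset.prod_pair (f := fun p : Fin ℓ =>
    (Polynomial.X - Polynomial.C (MvPolynomial.X p) : Polynomial (S ℓ))) hij]
  exact Finset.prod_dvd_prod_of_subset _ _ _ (Finset.subset_univ _)

theorem X_sub_X_pow_dvd_defInt_gpoly {ℓ : ℕ} {i j : Fin ℓ} (hij : i ≠ j) (m k : ℕ) :
    (MvPolynomial.X i - MvPolynomial.X j) ^ (2 * m + 1) ∣
      defInt (MvPolynomial.X i : S ℓ) (MvPolynomial.X j)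
        (Polynomial.X ^ k * gpoly ℓ ^ m) := by
  obtain ⟨r, hr⟩ := X_sub_C_mul_X_sub_C_dvd_gpoly hij
  have hdvd := sub_pow_dvd_defInt (MvPolynomial.X i : S ℓ) (MvPolynomial.X j) m m
    (Polynomial.X ^ k * r ^ m)
  have hg : (Polynomial.X - Polynomial.C (MvPolynomial.X i)) ^ m *
        (Polynomial.X - Polynomial.C (MvPolynomial.X j)) ^ m * (Polynomial.X ^ k * r ^ m) =
      Polynomial.X ^ k * gpoly ℓ ^ m := by
    rw [hr, mul_pow, mul_pow]
    ring
  rw [hg, ← two_mul] at hdvd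
  exact (pow_dvd_pow_of_dvd (neg_sub (MvPolynomial.X i : S ℓ) (MvPolynomial.X j) ▸
    (dvd_neg.mpr dvd_rfl)) _).trans hdvd

theorem eta_sub_eta (ℓ k m : ℕ) (i j : Fin ℓ) :
    eta ℓ k m i - eta ℓ k m j =
      ℓ • defInt (MvPolynomial.X i) (MvPolynomial.X j) (Polynomial.X ^ k * gpoly ℓ ^ m) := by
  unfold _root_.eta
  simp only [← Finset.sum_sub_distrib, defInt_sub_defInt, Finset.sum_const, Finset.card_univ,
    Fintype.card_fin]

theorem stmt2 (ℓ : ℕ) (hℓ : 2 ≤ ℓ) (m k : ℕ) :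
    (∀ i j : Fin ℓ, i < j →
      (MvPolynomial.X i - MvPolynomial.X j) ^ (2 * m + 1) ∣
        defInt (MvPolynomial.X i) (MvPolynomial.X j)
          (Polynomial.X ^ k * gpoly ℓ ^ m)) ∧
    eta ℓ k m ∈ DBset ℓ (2 * m + 1) := by
  refine ⟨fun i j hij => X_sub_X_pow_dvd_defInt_gpoly hij.ne m k, fun i j hij => ?_⟩
  rw [eta_sub_eta]
  exact dvd_nsmul_of_dvd _ (X_sub_X_pow_dvd_defInt_gpoly hij.ne m k)

end
end

section
/- Let ℓ ≥ 2. The ℓ vectors η_0^0, η_1^0, …, η_{ℓ-2}^0, θ_0 form a basis of the S-module D(B_ℓ, 1) = {(f_1,…,f_ℓ) ∈ S^ℓ : (x_i − x_j) divides f_i − f_j for all i < j}. -/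
open MvPolynomial Polynomial

noncomputable section

theorem MvPolynomial.X_sub_X_dvd_iff {σ R : Type*} [CommRing R] [DecidableEq σ] (i j : σ)
    (p : MvPolynomial σ R) :
    (MvPolynomial.X i - MvPolynomial.X j) ∣ p ↔
      aeval (Function.update MvPolynomial.X i (MvPolynomial.X j) : σ → MvPolynomial σ R) p = 0 := by
  set φ : MvPolynomial σ R →ₐ[R] MvPolynomial σ R :=
    aeval (Function.update MvPolynomial.X i (MvPolynomial.X j)) with hφ
  constructor
  · rintro ⟨q, rfl⟩
    have h : φ (MvPolynomial.X i) = φ (MvPolynomial.X j) := by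
      by_cases hij : j = i
      · rw [hij]
      · simp [hφ, Function.update_of_ne hij]
    rw [map_mul, map_sub, h, sub_self, zero_mul]
  · intro h
    let I : Ideal (MvPolynomial σ R) :=
      Ideal.span {(MvPolynomial.X i - MvPolynomial.X j : MvPolynomial σ R)}
    have hom : (Ideal.Quotient.mkₐ R I).comp φ = Ideal.Quotient.mkₐ R I := by
      ext k
      by_cases hk : k = i
      · subst hk
        simp only [hφ, AlgHom.comp_apply, aeval_X, Function.update_self,
          Ideal.Quotient.mkₐ_eq_mk]
        refine ((Ideal.Quotient.eq).2 ?_).symm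
        exact Ideal.subset_span rfl
      · simp [hφ, Function.update_of_ne hk]
    have hp := DFunLike.congr_fun hom p
    rw [AlgHom.comp_apply, h, map_zero] at hp
    exact Ideal.mem_span_singleton.1 (Ideal.Quotient.eq_zero_iff_mem.1 hp.symm)

theorem MvPolynomial.X_sub_X_dvd_of_dvd_mul {σ R : Type*} [CommRing R] [IsDomain R] {i j k : σ}
    (hik : i ≠ k) (hij : i ≠ j) (hkj : k ≠ j) (g : MvPolynomial σ R)
    (h : (MvPolynomial.X i - MvPolynomial.X j) ∣ (MvPolynomial.X j - MvPolynomial.X k) * g) :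
    (MvPolynomial.X i - MvPolynomial.X j) ∣ g := by
  classical
  rw [MvPolynomial.X_sub_X_dvd_iff] at h ⊢
  rw [map_mul, mul_eq_zero] at h
  refine h.resolve_left ?_
  simp only [map_sub, aeval_X, Function.update_of_ne hij.symm, Function.update_of_ne hik.symm]
  exact sub_ne_zero.2 fun e => hkj (MvPolynomial.X_injective e).symm

/-- Newton interpolation over a commutative ring: values whose differences are divisible by the
differences of the nodes are interpolated by a polynomial, provided the differences of the nodes
are pairwise coprime. -/
theorem Polynomial.exists_interpolation {R ι : Type*} [CommRing R] [DecidableEq ι] (x : ι → R)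
    (hx : ∀ i j k, i ≠ k → i ≠ j → k ≠ j → ∀ g, (x i - x j) ∣ (x j - x k) * g → (x i - x j) ∣ g)
    (s : Finset ι) (f : ι → R)
    (hf : ∀ i ∈ s, ∀ j ∈ s, i ≠ j → (x i - x j) ∣ f i - f j) :
    ∃ P : Polynomial R, P.degree < s.card ∧ ∀ i ∈ s, P.eval (x i) = f i := by
  induction s using Finset.induction_on generalizing f with
  | empty => exact ⟨0, by simp [bot_lt_iff_ne_bot]⟩
  | insert a s ha ih =>
    have hg : ∀ i, ∃ g, i ∈ s → f i - f a = (x i - x a) * g := by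
      intro i
      by_cases hi : i ∈ s
      · obtain ⟨g, hg⟩ := hf i (by simp [hi]) a (by simp) (ne_of_mem_of_not_mem hi ha)
        exact ⟨g, fun _ => hg⟩
      · exact ⟨0, fun h => absurd h hi⟩
    choose g hg using hg
    obtain ⟨Q, hQ, hQe⟩ := ih g (by
      intro i hi j hj hij
      refine hx i j a (ne_of_mem_of_not_mem hi ha) hij (ne_of_mem_of_not_mem hj ha).symm _ ?_
      have h := hf i (by simp [hi]) j (by simp [hj]) hij
      have e : (x j - x a) * (g i - g j) = (f i - f j) - (x i - x j) * g i := by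
        linear_combination (hg j hj) - (hg i hi)
      rw [e]
      exact h.sub (dvd_mul_right _ _))
    refine ⟨Polynomial.C (f a) + (Polynomial.X - Polynomial.C (x a)) * Q, ?_, ?_⟩
    · rw [Finset.card_insert_of_notMem ha]
      have hc : (Polynomial.C (f a)).degree < ((s.card + 1 : ℕ) : WithBot ℕ) :=
        Polynomial.degree_C_le.trans_lt (by exact_mod_cast Nat.succ_pos _)
      refine (Polynomial.degree_add_le _ _).trans_lt (max_lt hc ?_)
      by_cases h0 : Q = 0
      · rw [h0, mul_zero, Polynomial.degree_zero]
        exact WithBot.bot_lt_coe (s.card + 1)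
      have hn := (Polynomial.natDegree_lt_iff_degree_lt h0).2 hQ
      calc ((Polynomial.X - Polynomial.C (x a)) * Q).degree
          ≤ (Polynomial.X - Polynomial.C (x a)).degree + Q.degree := Polynomial.degree_mul_le _ _
        _ ≤ ((1 : ℕ) : WithBot ℕ) + (Q.natDegree : ℕ) :=
          add_le_add (Polynomial.degree_X_sub_C_le _) Polynomial.degree_le_natDegree
        _ < ((s.card + 1 : ℕ) : WithBot ℕ) := by
          rw [← Nat.cast_add, Nat.cast_lt]
          omega
    · intro i hi
      rcases Finset.mem_insert.1 hi with rfl | hi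
      · simp
      · simp only [Polynomial.eval_add, Polynomial.eval_C, Polynomial.eval_mul,
          Polynomial.eval_sub, Polynomial.eval_X, hQe i hi, ← hg i hi]
        ring

theorem eta_zero_apply (ℓ k : ℕ) (i : Fin ℓ) :
    eta ℓ k 0 i = MvPolynomial.C (((k : ℂ) + 1)⁻¹) *
      ((∑ j, MvPolynomial.X j ^ (k + 1)) - MvPolynomial.C (ℓ : ℂ) * MvPolynomial.X i ^ (k + 1)) := by
  have h1 : ((((k : ℚ) + 1)⁻¹) • (1 : S ℓ)) = MvPolynomial.C (((k : ℂ) + 1)⁻¹) := by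
    rw [← Algebra.algebraMap_eq_smul_one, IsScalarTower.algebraMap_apply ℚ ℂ (S ℓ), eq_ratCast,
      MvPolynomial.algebraMap_eq]
    push_cast
    rfl
  simp only [_root_.eta, defInt, pow_zero, mul_one]
  simp_rw [← Polynomial.monomial_one_right_eq_X_pow]
  simp only [Polynomial.sum_monomial_index, smul_zero, zero_mul, h1]
  rw [← Finset.mul_sum, Finset.sum_sub_distrib]
  simp

theorem etaBasis_castSucc (n m : ℕ) (a : Fin n) :
    etaBasis (n + 1) m a.castSucc = eta (n + 1) a m := by
  simp [etaBasis]

theorem etaBasis_last (n m : ℕ) : etaBasis (n + 1) m (Fin.last n) = theta0 (n + 1) := by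
  simp [etaBasis]

theorem linearIndependent_etaBasis_s3 (n : ℕ) :
    LinearIndependent (S (n + 1)) (etaBasis (n + 1) 0) := by
  rw [Fintype.linearIndependent_iff]
  intro c hc
  let p (k : ℕ) : S (n + 1) := ∑ j, MvPolynomial.X j ^ (k + 1)
  let u (a : Fin n) : S (n + 1) := c a.castSucc * MvPolynomial.C (((a : ℂ) + 1)⁻¹)
  let P : Polynomial (S (n + 1)) :=
    ∑ a : Fin n, Polynomial.C (u a) *
      (Polynomial.C (p a) - Polynomial.C (MvPolynomial.C ((n + 1 : ℕ) : ℂ)) *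
        Polynomial.X ^ ((a : ℕ) + 1)) + Polynomial.C (c (Fin.last n))
  have hP : P = 0 := by
    refine Polynomial.eq_zero_of_degree_lt_of_eval_index_eq_zero
      (s := Finset.univ) (v := fun i : Fin (n + 1) => (MvPolynomial.X i : S (n + 1)))
      (MvPolynomial.X_injective.injOn) ?_ ?_
    · rw [← Polynomial.mem_degreeLT]
      have hC : ∀ r, Polynomial.C r ∈
          Polynomial.degreeLT (S (n + 1)) (Finset.univ : Finset (Fin (n + 1))).card := by
        intro r
        rw [Polynomial.mem_degreeLT]
        exact Polynomial.degree_C_le.trans_lt (by simp; exact_mod_cast Nat.succ_pos n)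
      refine Submodule.add_mem _ (Submodule.sum_mem _ fun a _ => ?_) (hC _)
      rw [← Polynomial.smul_eq_C_mul, ← Polynomial.smul_eq_C_mul]
      refine Submodule.smul_mem _ _ (Submodule.sub_mem _ (hC _) (Submodule.smul_mem _ _ ?_))
      rw [Polynomial.mem_degreeLT]
      refine (Polynomial.degree_X_pow_le _).trans_lt ?_
      have := a.2
      simp
      exact_mod_cast Nat.succ_lt_succ this
    · intro i _
      have h := congrFun hc i
      rw [Fin.sum_univ_castSucc] at h
      simp only [etaBasis_castSucc, etaBasis_last, Pi.add_apply, Finset.sum_apply, Pi.smul_apply,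
        smul_eq_mul, eta_zero_apply, theta0, mul_one, Pi.zero_apply, ← mul_assoc] at h
      simpa [P, p, u, Polynomial.eval_finsetSum] using h
  have hcast : ∀ a : Fin n, c a.castSucc = 0 := by
    intro a
    have h := congrArg (fun Q => Polynomial.coeff Q ((a : ℕ) + 1)) hP
    simp only [P, Polynomial.coeff_add, Polynomial.finsetSum_coeff, Polynomial.coeff_C_mul,
      Polynomial.coeff_sub, Polynomial.coeff_X_pow, Polynomial.coeff_C_succ, add_zero,
      Polynomial.coeff_zero, add_left_inj, ← Fin.ext_iff] at h
    rw [Finset.sum_eq_single a (fun b _ hb => by simp [hb.symm]) (by simp)] at h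
    have hn : (MvPolynomial.C ((n + 1 : ℕ) : ℂ) : S (n + 1)) ≠ 0 := by
      rw [Ne, MvPolynomial.C_eq_zero]
      exact_mod_cast Nat.succ_ne_zero n
    have ha : (MvPolynomial.C (((a : ℂ) + 1)⁻¹) : S (n + 1)) ≠ 0 := by
      rw [Ne, MvPolynomial.C_eq_zero]
      exact inv_ne_zero (by exact_mod_cast Nat.succ_ne_zero (a : ℕ))
    simpa only [u, zero_sub, mul_ite, mul_one, mul_zero, if_true, mul_neg, neg_eq_zero, mul_eq_zero,
      hn, ha, or_false] using h
  refine Fin.lastCases ?_ hcast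
  simpa [P, u, hcast] using hP

theorem pow_mem_span_etaBasis (n k : ℕ) (hk : k < n + 1) :
    (fun i => MvPolynomial.X i ^ k : Fin (n + 1) → S (n + 1)) ∈
      Submodule.span (S (n + 1)) (Set.range (etaBasis (n + 1) 0)) := by
  have hθ : theta0 (n + 1) ∈ Submodule.span (S (n + 1)) (Set.range (etaBasis (n + 1) 0)) :=
    etaBasis_last n 0 ▸ Submodule.subset_span ⟨_, rfl⟩
  obtain _ | k := k
  · simp only [pow_zero]
    exact hθ
  have hη : eta (n + 1) k 0 ∈ Submodule.span (S (n + 1)) (Set.range (etaBasis (n + 1) 0)) :=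
    etaBasis_castSucc n 0 ⟨k, by omega⟩ ▸ Submodule.subset_span ⟨_, rfl⟩
  have hn : (MvPolynomial.C (((n + 1 : ℕ) : ℂ)⁻¹) * MvPolynomial.C ((n + 1 : ℕ) : ℂ) :
      S (n + 1)) = 1 := by
    rw [← MvPolynomial.C_mul, inv_mul_cancel₀ (by exact_mod_cast Nat.succ_ne_zero n),
      MvPolynomial.C_1]
  have hk1 : (MvPolynomial.C ((k : ℂ) + 1) * MvPolynomial.C (((k : ℂ) + 1)⁻¹) :
      S (n + 1)) = 1 := by
    rw [← MvPolynomial.C_mul, mul_inv_cancel₀ (by exact_mod_cast Nat.succ_ne_zero k),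
      MvPolynomial.C_1]
  convert Submodule.smul_mem _ (MvPolynomial.C (((n + 1 : ℕ) : ℂ)⁻¹) : S (n + 1))
    (Submodule.sub_mem _ (Submodule.smul_mem _ (∑ j, MvPolynomial.X j ^ (k + 1)) hθ)
      (Submodule.smul_mem _ (MvPolynomial.C ((k : ℂ) + 1)) hη)) using 1
  funext i
  simp only [Pi.smul_apply, Pi.sub_apply, smul_eq_mul, theta0, eta_zero_apply, ← mul_assoc, hk1]
  linear_combination (-MvPolynomial.X i ^ (k + 1)) * hn

theorem etaBasis_zero_mem_DB (n : ℕ) (a : Fin (n + 1)) :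
    etaBasis (n + 1) 0 a ∈ DB (n + 1) 1 := by
  intro i j _
  rw [pow_one]
  refine Fin.lastCases ?_ (fun a => ?_) a
  · simp [etaBasis_last, theta0]
  · rw [etaBasis_castSucc, eta_zero_apply, eta_zero_apply, ← mul_sub, sub_sub_sub_cancel_left,
      ← mul_sub]
    exact (((sub_dvd_pow_sub_pow _ _ _).neg_right.trans (by rw [neg_sub])).mul_left _).mul_left _

theorem DB_one_le_span_etaBasis (n : ℕ) :
    DB (n + 1) 1 ≤ Submodule.span (S (n + 1)) (Set.range (etaBasis (n + 1) 0)) := by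
  intro v hv
  have hv' : ∀ i j, i < j → (MvPolynomial.X i - MvPolynomial.X j) ∣ v i - v j := by
    simpa [DB] using hv
  obtain ⟨P, hP, hPe⟩ := Polynomial.exists_interpolation
    (fun i : Fin (n + 1) => (MvPolynomial.X i : S (n + 1)))
    (fun i j k hik hij hkj g h => MvPolynomial.X_sub_X_dvd_of_dvd_mul hik hij hkj g h)
    Finset.univ v (by
      intro i _ j _ hij
      rcases lt_or_gt_of_ne hij with h | h
      · exact hv' i j h
      · have := hv' j i h
        rwa [← neg_sub, neg_dvd, ← neg_sub (v i), dvd_neg] at this)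
  have e : v = ∑ k ∈ Finset.range (n + 1), P.coeff k • fun i => MvPolynomial.X i ^ k := by
    funext i
    rw [← hPe i (Finset.mem_univ _), Polynomial.eval_eq_sum_range' (n := n + 1)]
    · simp
    · rw [Finset.card_univ, Fintype.card_fin] at hP
      by_cases h0 : P = 0
      · simp [h0]
      · exact (Polynomial.natDegree_lt_iff_degree_lt h0).2 hP
  rw [e]
  exact Submodule.sum_mem _ fun k hk => Submodule.smul_mem _ _
    (pow_mem_span_etaBasis n k (Finset.mem_range.1 hk))

theorem stmt3 (ℓ : ℕ) (hℓ : 2 ≤ ℓ) :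
    (∀ a : Fin ℓ, etaBasis ℓ 0 a ∈ DB ℓ 1) ∧
    LinearIndependent (S ℓ) (etaBasis ℓ 0) ∧
    (∀ v ∈ DB ℓ 1,
      v ∈ Submodule.span (S ℓ) (Set.range (etaBasis ℓ 0))) := by
  obtain ⟨n, rfl⟩ : ∃ n, ℓ = n + 1 := ⟨ℓ - 1, by omega⟩
  exact ⟨etaBasis_zero_mem_DB n, linearIndependent_etaBasis_s3 n, DB_one_le_span_etaBasis n⟩

end
end

section
/- Let ℓ ≥ 2, m ≥ 1, k ≥ 0 and 1 ≤ v ≤ ℓ be integers, and let p be an integer with 1 ≤ p ≤ m. Then the definite summation Σ_{x_v}^{x_v + p} t^k g(t)^{\underline{m}} Δt = Σ_{s=0}^{p−1} (x_v + s)^k g(x_v+s) g(x_v+s−1) ⋯ g(x_v+s−m+1) equals 0 in ℂ[x_1,…,x_ℓ]. -/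
open MvPolynomial Polynomial

noncomputable section

/-- Falling power f(t)^{\underline{m}} = f(t) f(t-1) ⋯ f(t-m+1). -/
def fpow {A : Type*} [CommRing A] (f : Polynomial A) (m : ℕ) : Polynomial A :=
  ∏ i ∈ Finset.range m, f.comp (Polynomial.X - (i : Polynomial A))

theorem eval_add_natCast_sub_eval_of_comp_X_add_one_sub {A : Type*} [CommRing A]
    {F f : Polynomial A} (hF : F.comp (Polynomial.X + 1) - F = f) (a : A) (n : ℕ) :
    F.eval (a + n) - F.eval a = ∑ s ∈ Finset.range n, f.eval (a + s) := by
  have h : ∀ s : ℕ, f.eval (a + s) = F.eval (a + (s + 1 : ℕ)) - F.eval (a + s) := by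
    intro s
    simp [← hF, add_assoc]
  simp only [h]
  simpa using (Finset.sum_range_sub (fun s : ℕ => F.eval (a + (s : A))) n).symm

theorem eval_fpow_add_natCast_eq_zero {A : Type*} [CommRing A] {f : Polynomial A} {a : A}
    (ha : f.eval a = 0) {m s : ℕ} (hs : s < m) : (fpow f m).eval (a + s) = 0 := by
  rw [fpow, Polynomial.eval_prod]
  exact Finset.prod_eq_zero (Finset.mem_range.2 hs) (by simp [ha])

theorem eval_gpoly_X {ℓ : ℕ} (v : Fin ℓ) : (gpoly ℓ).eval (MvPolynomial.X v) = 0 := by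
  rw [gpoly, Polynomial.eval_prod]
  exact Finset.prod_eq_zero (Finset.mem_univ v) (by simp)

theorem stmt8 (ℓ : ℕ) (hℓ : 2 ≤ ℓ) (m k : ℕ) (hm : 1 ≤ m) (v : Fin ℓ)
    (p : ℕ) (hp1 : 1 ≤ p) (hpm : p ≤ m)
    -- F is an indefinite summation (antidifference) of t^k g(t)^{\underline{m}}
    (F : Polynomial (S ℓ))
    (hF : F.comp (Polynomial.X + 1) - F = Polynomial.X ^ k * fpow (gpoly ℓ) m) :
    F.eval (MvPolynomial.X v + (p : S ℓ)) - F.eval (MvPolynomial.X v) =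
      ∑ s ∈ Finset.range p,
        (Polynomial.X ^ k * fpow (gpoly ℓ) m).eval (MvPolynomial.X v + (s : S ℓ)) ∧
    F.eval (MvPolynomial.X v + (p : S ℓ)) - F.eval (MvPolynomial.X v) = 0 := by
  have hsum := eval_add_natCast_sub_eval_of_comp_X_add_one_sub hF (MvPolynomial.X v) p
  refine ⟨hsum, hsum.trans (Finset.sum_eq_zero fun s hs => ?_)⟩
  rw [Polynomial.eval_mul, eval_fpow_add_natCast_eq_zero (eval_gpoly_X v)
    ((Finset.mem_range.1 hs).trans_le hpm), mul_zero]

end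
end

section
/- Let ℓ ≥ 2, m ≥ 1, k ≥ 0 be integers with k ≤ ℓ − 2. The top-degree homogeneous component (of degree mℓ + k + 1) of the polynomial Σ_{x_i}^{x_j} t^k g(t)^{\underline{m}} Δt ∈ ℂ[x_1,…,x_ℓ] equals ∫_{x_i}^{x_j} t^k g(t)^m dt; consequently the homogenized vector field ζ̃_k^m restricted to z = 0 equals η_k^m. -/
open MvPolynomial Polynomial

noncomputable section

section Graded

variable {σ R : Type*} [CommRing R]

/-- Polynomials all of whose monomials have degree in `A`. -/
def degIn (σ R : Type*) [CommRing R] (A : Set ℕ) : AddSubgroup (MvPolynomial σ R) where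
  carrier := {p | ∀ s, p.coeff s ≠ 0 → s.degree ∈ A}
  zero_mem' := by simp
  add_mem' := by
    intro p q hp hq s hs
    by_cases h : p.coeff s = 0
    · exact hq s (by simpa [h] using hs)
    · exact hp s h
  neg_mem' := by
    intro p hp s hs
    exact hp s (by simpa using hs)

lemma degIn_mono {A B : Set ℕ} (h : A ⊆ B) : degIn σ R A ≤ degIn σ R B :=
  fun _ hp s hs => h (hp s hs)

lemma mul_mem_degIn {A B D : Set ℕ} (h : ∀ a ∈ A, ∀ b ∈ B, a + b ∈ D) {p q : MvPolynomial σ R}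
    (hp : p ∈ degIn σ R A) (hq : q ∈ degIn σ R B) : p * q ∈ degIn σ R D := by
  classical
  intro s hs
  rw [MvPolynomial.coeff_mul] at hs
  obtain ⟨x, hx, hne⟩ := Finset.exists_ne_zero_of_sum_ne_zero hs
  rw [← Finset.HasAntidiagonal.mem_antidiagonal.1 hx, map_add]
  exact h _ (hp _ (left_ne_zero_of_mul hne)) _ (hq _ (right_ne_zero_of_mul hne))

lemma C_mem_degIn (r : R) : (MvPolynomial.C r : MvPolynomial σ R) ∈ degIn σ R {0} := by
  classical
  intro s hs
  have : 0 = s := by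
    by_contra h
    simp [MvPolynomial.coeff_C, h] at hs
  simp [← this]

lemma X_pow_mem_degIn (i : σ) (n : ℕ) :
    (MvPolynomial.X i ^ n : MvPolynomial σ R) ∈ degIn σ R {n} := by
  classical
  intro s hs
  have : Finsupp.single i n = s := by
    by_contra h
    simp [MvPolynomial.coeff_X_pow, h] at hs
  simp [← this]

/-- Polynomials in `t` over `MvPolynomial σ R` all of whose monomials have degree in `A`,
where `t` has degree one. -/
def wtIn (σ R : Type*) [CommRing R] (A : Set ℕ) :
    AddSubgroup (Polynomial (MvPolynomial σ R)) where
  carrier := {P | ∀ n, P.coeff n ∈ degIn σ R {d | d + n ∈ A}}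
  zero_mem' := by simp
  add_mem' := by
    intro P Q hP hQ n
    rw [Polynomial.coeff_add]
    exact add_mem (hP n) (hQ n)
  neg_mem' := by
    intro P hP n
    rw [Polynomial.coeff_neg]
    exact neg_mem (hP n)

lemma wtIn_mono {A B : Set ℕ} (h : A ⊆ B) : wtIn σ R A ≤ wtIn σ R B :=
  fun _ hP n => degIn_mono (B := {d | d + n ∈ B}) (fun _ hd => h hd) (hP n)

lemma mul_mem_wtIn {A B D : Set ℕ} (h : ∀ a ∈ A, ∀ b ∈ B, a + b ∈ D)
    {P Q : Polynomial (MvPolynomial σ R)}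
    (hP : P ∈ wtIn σ R A) (hQ : Q ∈ wtIn σ R B) : P * Q ∈ wtIn σ R D := by
  intro n
  rw [Polynomial.coeff_mul]
  refine sum_mem fun x hx => mul_mem_degIn (fun a ha b hb => ?_) (hP x.1) (hQ x.2)
  have := h _ ha _ hb
  rw [← Finset.HasAntidiagonal.mem_antidiagonal.1 hx]
  simpa [add_add_add_comm] using this

lemma C_mem_wtIn {A : Set ℕ} {p : MvPolynomial σ R} (hp : p ∈ degIn σ R A) :
    Polynomial.C p ∈ wtIn σ R A := by
  intro n
  rw [Polynomial.coeff_C]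
  split_ifs with h
  · subst h
    exact hp
  · exact zero_mem _

lemma T_mem_wtIn : (Polynomial.X : Polynomial (MvPolynomial σ R)) ∈ wtIn σ R {1} := by
  intro n
  rw [Polynomial.coeff_X]
  split_ifs with h
  · subst h
    rw [← MvPolynomial.C_1]
    exact degIn_mono (by simp) (C_mem_degIn 1)
  · exact zero_mem _

lemma eval_X_mem_degIn {A : Set ℕ} {P : Polynomial (MvPolynomial σ R)} (hP : P ∈ wtIn σ R A)
    (i : σ) : P.eval (MvPolynomial.X i) ∈ degIn σ R A := by
  rw [Polynomial.eval_eq_sum, Polynomial.sum_def]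
  refine sum_mem fun n _ => mul_mem_degIn ?_ (hP n) (X_pow_mem_degIn i n)
  rintro a ha b rfl
  exact ha

/-- `Q` is homogeneous of degree `N` and is the part of degree `N` of `P`, which has no part of
higher degree. -/
def IsLeadingForm (N : ℕ) (P Q : Polynomial (MvPolynomial σ R)) : Prop :=
  Q ∈ wtIn σ R {N} ∧ P - Q ∈ wtIn σ R (Set.Iio N)

namespace IsLeadingForm

lemma one : IsLeadingForm 0 (1 : Polynomial (MvPolynomial σ R)) 1 := by
  refine ⟨?_, by rw [sub_self]; exact zero_mem _⟩
  have := C_mem_wtIn (C_mem_degIn (σ := σ) (1 : R))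
  simpa using this

lemma mul {M N : ℕ} {P Q P' Q' : Polynomial (MvPolynomial σ R)} (h : IsLeadingForm M P Q)
    (h' : IsLeadingForm N P' Q') : IsLeadingForm (M + N) (P * P') (Q * Q') := by
  refine ⟨mul_mem_wtIn (by simp) h.1 h'.1, ?_⟩
  rw [show P * P' - Q * Q' = (P - Q) * (P' - Q') + (P - Q) * Q' + Q * (P' - Q') by ring]
  refine add_mem (add_mem (mul_mem_wtIn ?_ h.2 h'.2) (mul_mem_wtIn ?_ h.2 h'.1))
    (mul_mem_wtIn ?_ h.1 h'.2)
  all_goals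
    intro a ha b hb
    simp only [Set.mem_Iio, Set.mem_singleton_iff] at *
    omega

lemma prod {ι : Type*} (s : Finset ι) {N : ℕ} {P Q : ι → Polynomial (MvPolynomial σ R)}
    (h : ∀ i ∈ s, IsLeadingForm N (P i) (Q i)) :
    IsLeadingForm (s.card * N) (∏ i ∈ s, P i) (∏ i ∈ s, Q i) := by
  classical
  induction s using Finset.induction_on with
  | empty => simpa using one
  | insert a s ha ih =>
    rw [Finset.prod_insert ha, Finset.prod_insert ha, Finset.card_insert_of_notMem ha,
      add_mul, one_mul, add_comm]
    exact (h a (Finset.mem_insert_self a s)).mul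
      (ih fun i hi => h i (Finset.mem_insert_of_mem hi))

lemma T_pow (k : ℕ) :
    IsLeadingForm k (Polynomial.X ^ k : Polynomial (MvPolynomial σ R)) (Polynomial.X ^ k) := by
  have := prod (Finset.range k) (N := 1) (P := fun _ => Polynomial.X) (Q := fun _ => Polynomial.X)
    (σ := σ) (R := R) fun _ _ => ⟨T_mem_wtIn, by rw [sub_self]; exact zero_mem _⟩
  simpa using this

lemma linear (c : ℕ) (i : σ) :
    IsLeadingForm 1
      (Polynomial.X - (c : Polynomial (MvPolynomial σ R)) - Polynomial.C (MvPolynomial.X i))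
      (Polynomial.X - Polynomial.C (MvPolynomial.X i)) := by
  refine ⟨sub_mem T_mem_wtIn (C_mem_wtIn ?_), ?_⟩
  · simpa using X_pow_mem_degIn (R := R) i 1
  · rw [sub_sub_sub_cancel_right, sub_sub_cancel_left]
    refine neg_mem ?_
    have := C_mem_wtIn (C_mem_degIn (σ := σ) (c : R))
    simp only [map_natCast] at this
    exact wtIn_mono (by simp) this

end IsLeadingForm

/-- The linear operator on polynomials in `t` sending `t ^ n` to `b n`. -/
def substBasis {A : Type*} [CommRing A] [Algebra ℚ A] (b : ℕ → Polynomial ℚ) :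
    Polynomial A →ₗ[A] Polynomial A :=
  Polynomial.lsum fun n => LinearMap.toSpanSingleton A _ ((b n).map (algebraMap ℚ A))

lemma substBasis_apply {A : Type*} [CommRing A] [Algebra ℚ A] (b : ℕ → Polynomial ℚ)
    (P : Polynomial A) :
    substBasis b P = P.sum fun n c => c • (b n).map (algebraMap ℚ A) := by
  simp [substBasis, Polynomial.lsum_apply]

lemma substBasis_mem_wtIn [Algebra ℚ R] {A B : Set ℕ} {b : ℕ → Polynomial ℚ}
    (hb : ∀ n e, (b n).coeff e ≠ 0 → ∀ d, d + n ∈ A → d + e ∈ B)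
    {P : Polynomial (MvPolynomial σ R)} (hP : P ∈ wtIn σ R A) :
    substBasis b P ∈ wtIn σ R B := by
  intro e
  rw [substBasis_apply, Polynomial.sum_def, Polynomial.finsetSum_coeff]
  refine sum_mem fun n _ => ?_
  rw [Polynomial.coeff_smul, Polynomial.coeff_map, smul_eq_mul]
  by_cases h : (b n).coeff e = 0
  · rw [h, map_zero, mul_zero]
    exact zero_mem _
  · refine mul_mem_degIn ?_ (hP n) (C_mem_degIn (algebraMap ℚ R ((b n).coeff e)))
    rintro a ha _ rfl
    exact hb n e h a ha

end Graded

section Antidifference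

/-- The antidifference of `t ^ n` given by Bernoulli polynomials. -/
def powAntidiff (n : ℕ) : Polynomial ℚ :=
  Polynomial.C ((n : ℚ) + 1)⁻¹ * Polynomial.bernoulli (n + 1)

/-- The antiderivative of `t ^ n`. -/
def powAntideriv (n : ℕ) : Polynomial ℚ :=
  Polynomial.C ((n : ℚ) + 1)⁻¹ * Polynomial.X ^ (n + 1)

lemma powAntidiff_comp_sub (n : ℕ) :
    (powAntidiff n).comp (Polynomial.X + 1) - powAntidiff n = Polynomial.X ^ n := by
  have h := Polynomial.bernoulli_comp_one_add_X (n + 1)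
  have hn : ((n : ℚ) + 1) ≠ 0 := by positivity
  rw [powAntidiff, Polynomial.mul_comp, Polynomial.C_comp, add_comm Polynomial.X, h, ← mul_sub,
    add_sub_cancel_left, Nat.add_sub_cancel, nsmul_eq_mul, ← mul_assoc,
    ← map_natCast Polynomial.C, ← map_mul]
  push_cast
  rw [inv_mul_cancel₀ hn, map_one, one_mul]

lemma coeff_powAntidiff_sub_powAntideriv {n e : ℕ}
    (h : (powAntidiff n - powAntideriv n).coeff e ≠ 0) : e ≤ n := by
  by_contra! hlt
  apply h
  rw [powAntidiff, powAntideriv, ← mul_sub, Polynomial.coeff_C_mul, Polynomial.coeff_sub,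
    Polynomial.coeff_bernoulli, Polynomial.coeff_X_pow]
  rcases (Nat.succ_le_of_lt hlt).eq_or_lt with rfl | hlt'
  · simp
  · rw [if_neg (by omega), if_neg (by omega), sub_zero, mul_zero]

lemma coeff_powAntideriv {n e : ℕ} (h : (powAntideriv n).coeff e ≠ 0) : e = n + 1 := by
  by_contra hne
  simp [powAntideriv, Polynomial.coeff_X_pow, hne] at h

variable {A : Type*} [CommRing A] [Algebra ℚ A]

lemma substBasis_powAntidiff_comp_sub (P : Polynomial A) :
    (substBasis powAntidiff P).comp (Polynomial.X + 1) - substBasis powAntidiff P = P := by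
  have h (n : ℕ) : ((powAntidiff n).map (algebraMap ℚ A)).comp (Polynomial.X + 1) =
      (powAntidiff n).map (algebraMap ℚ A) + Polynomial.X ^ n := by
    have := congrArg (Polynomial.map (algebraMap ℚ A)) (powAntidiff_comp_sub n)
    simp only [Polynomial.map_sub, Polynomial.map_comp, Polynomial.map_add, Polynomial.map_X,
      Polynomial.map_one, Polynomial.map_pow] at this
    rw [← this]
    ring
  conv_rhs => rw [P.as_sum_support_C_mul_X_pow]
  simp_rw [substBasis_apply, Polynomial.sum_def, Polynomial.sum_comp, Polynomial.smul_comp, h,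
    smul_add, Finset.sum_add_distrib, add_sub_cancel_left, Polynomial.smul_eq_C_mul]

lemma defInt_eq_eval_sub (a b : A) (P : Polynomial A) :
    defInt a b P = (substBasis powAntideriv P).eval b - (substBasis powAntideriv P).eval a := by
  simp_rw [defInt, substBasis_apply, Polynomial.sum_def, Polynomial.eval_finsetSum,
    ← Finset.sum_sub_distrib]
  refine Finset.sum_congr rfl fun n _ => ?_
  rw [Polynomial.eval_smul, Polynomial.eval_smul]
  simp only [powAntideriv, Polynomial.map_mul, Polynomial.map_C, Polynomial.map_pow,
    Polynomial.map_X, Polynomial.eval_mul, Polynomial.eval_C,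
    Polynomial.eval_pow, Polynomial.eval_X, smul_eq_mul, Algebra.smul_def]
  ring

lemma eq_C_of_comp_X_add_one [IsDomain A] {G : Polynomial A}
    (h : G.comp (Polynomial.X + 1) = G) : G = Polynomial.C (G.eval 0) := by
  have : CharZero A := algebraRat.charZero A
  have key (n : ℕ) : G.eval (n : A) = G.eval 0 := by
    induction n with
    | zero => simp
    | succ n ih =>
      rw [← ih]
      conv_rhs => rw [← h]
      simp
  refine Polynomial.eq_of_infinite_eval_eq _ _
    ((Set.infinite_range_of_injective (Nat.cast_injective (R := A))).mono ?_)
  rintro _ ⟨n, rfl⟩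
  simp [key n]

lemma eval_sub_eq_of_comp_sub_eq [IsDomain A] {F P : Polynomial A}
    (hF : F.comp (Polynomial.X + 1) - F = P) (a b : A) :
    F.eval b - F.eval a =
      (substBasis powAntidiff P).eval b - (substBasis powAntidiff P).eval a := by
  have h := eq_C_of_comp_X_add_one (G := F - substBasis powAntidiff P) (by
    rw [Polynomial.sub_comp]
    linear_combination hF - substBasis_powAntidiff_comp_sub P)
  have hb := congrArg (Polynomial.eval b) h
  have ha := congrArg (Polynomial.eval a) h
  rw [Polynomial.eval_sub, Polynomial.eval_C] at ha hb
  linear_combination hb - ha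

end Antidifference

lemma IsLeadingForm.antidiff {σ R : Type*} [CommRing R] [Algebra ℚ R] {N : ℕ}
    {P Q : Polynomial (MvPolynomial σ R)} (h : IsLeadingForm N P Q) :
    IsLeadingForm (N + 1) (substBasis powAntidiff P) (substBasis powAntideriv Q) := by
  refine ⟨substBasis_mem_wtIn (fun n e he d hd => ?_) h.1, ?_⟩
  · rw [coeff_powAntideriv he, ← add_assoc, Set.mem_singleton_iff.1 hd]
    rfl
  · have hP : P ∈ wtIn σ R (Set.Iio (N + 1)) := by
      rw [← sub_add_cancel P Q]
      exact add_mem (wtIn_mono (Set.Iio_subset_Iio N.le_succ) h.2) (wtIn_mono (by simp) h.1)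
    have hsub : substBasis powAntidiff P - substBasis powAntideriv Q =
        substBasis (fun n => powAntidiff n - powAntideriv n) P +
          substBasis powAntideriv (P - Q) := by
      rw [map_sub, add_sub, sub_left_inj]
      simp_rw [substBasis_apply, Polynomial.sum_def, ← Finset.sum_add_distrib, ← smul_add,
        Polynomial.map_sub, sub_add_cancel]
    rw [hsub]
    refine add_mem (substBasis_mem_wtIn (fun n e he d hd => ?_) hP)
      (substBasis_mem_wtIn (fun n e he d hd => ?_) h.2)
    · have := coeff_powAntidiff_sub_powAntideriv he
      simp only [Set.mem_Iio] at *
      omega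
    · have := coeff_powAntideriv he
      simp only [Set.mem_Iio] at *
      omega

lemma isLeadingForm_fpow (ℓ k m : ℕ) :
    IsLeadingForm (m * ℓ + k) (Polynomial.X ^ k * fpow (gpoly ℓ) m)
      (Polynomial.X ^ k * gpoly ℓ ^ m) := by
  rw [add_comm]
  refine (IsLeadingForm.T_pow k).mul ?_
  have hg (c : ℕ) : IsLeadingForm ℓ ((gpoly ℓ).comp (Polynomial.X - (c : Polynomial (S ℓ))))
      (gpoly ℓ) := by
    have := IsLeadingForm.prod (Finset.univ : Finset (Fin ℓ))
      fun p _ => IsLeadingForm.linear (R := ℂ) c p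
    simpa [gpoly, Polynomial.prod_comp] using this
  have := IsLeadingForm.prod (Finset.range m) fun c _ => hg c
  simpa [fpow] using this

lemma totalDegree_le_and_homogeneousComponent_eq {σ R : Type*} [CommRing R] {N : ℕ}
    {p q : MvPolynomial σ R} (hq : q ∈ degIn σ R {N}) (hpq : p - q ∈ degIn σ R (Set.Iio N)) :
    p.totalDegree ≤ N ∧ MvPolynomial.homogeneousComponent N p = q := by
  constructor
  · have hp : p ∈ degIn σ R (Set.Iic N) := by
      rw [← sub_add_cancel p q]
      exact add_mem (degIn_mono Set.Iio_subset_Iic_self hpq) (degIn_mono (by simp) hq)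
    refine Finset.sup_le fun s hs => ?_
    exact hp s (MvPolynomial.mem_support_iff.1 hs)
  · ext s
    rw [MvPolynomial.coeff_homogeneousComponent]
    split_ifs with h
    · by_contra hne
      exact absurd h (ne_of_lt (hpq s (by rwa [MvPolynomial.coeff_sub, sub_ne_zero])))
    · by_contra hne
      exact h (hq s (Ne.symm hne))

theorem stmt10 (ℓ : ℕ) (hℓ : 2 ≤ ℓ) (m k : ℕ) (hm : 1 ≤ m) (hk : k ≤ ℓ - 2)
    -- F is an indefinite summation (antidifference) of t^k g(t)^{\underline{m}}
    (F : Polynomial (S ℓ))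
    (hF : F.comp (Polynomial.X + 1) - F = Polynomial.X ^ k * fpow (gpoly ℓ) m) :
    (∀ i j : Fin ℓ,
      (F.eval (MvPolynomial.X j) - F.eval (MvPolynomial.X i)).totalDegree ≤ m * ℓ + k + 1 ∧
      MvPolynomial.homogeneousComponent (m * ℓ + k + 1)
          (F.eval (MvPolynomial.X j) - F.eval (MvPolynomial.X i)) =
        defInt (MvPolynomial.X i) (MvPolynomial.X j)
          (Polynomial.X ^ k * gpoly ℓ ^ m)) ∧
    -- consequently, the homogenized ζ̃_k^m restricted to z = 0 equals η_k^m: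
    -- the top-degree component of each coefficient of ζ_k^m is the corresponding
    -- coefficient of η_k^m
    (∀ i : Fin ℓ,
      MvPolynomial.homogeneousComponent (m * ℓ + k + 1)
          (∑ j : Fin ℓ, (F.eval (MvPolynomial.X j) - F.eval (MvPolynomial.X i))) =
        eta ℓ k m i) := by
  have key (i j : Fin ℓ) := by
    have h := (isLeadingForm_fpow ℓ k m).antidiff
    refine totalDegree_le_and_homogeneousComponent_eq
      (p := F.eval (MvPolynomial.X j) - F.eval (MvPolynomial.X i))
      (q := defInt (MvPolynomial.X i) (MvPolynomial.X j) (Polynomial.X ^ k * gpoly ℓ ^ m))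
      (N := m * ℓ + k + 1) ?_ ?_
    · rw [defInt_eq_eval_sub]
      exact sub_mem (eval_X_mem_degIn h.1 j) (eval_X_mem_degIn h.1 i)
    · rw [defInt_eq_eval_sub, eval_sub_eq_of_comp_sub_eq hF, sub_sub_sub_comm,
        ← Polynomial.eval_sub, ← Polynomial.eval_sub]
      exact sub_mem (eval_X_mem_degIn h.2 j) (eval_X_mem_degIn h.2 i)
  refine ⟨key, fun i => ?_⟩
  rw [map_sum, _root_.eta]
  exact Finset.sum_congr rfl fun j _ => (key i j).2

end
end
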